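/- There exist constants C > 0 and λ₀ > 0 such that for all real λ ≥ λ₀, the first moment of L satisfies |Ex[L] − λ/2 − (log λ)/2| ≤ C. -/

import Mathlib

/-- `D lam l = ∑_{k=0}^{l} l! / ((l-k)! * lam^k)`. -/
noncomputable def D (lam : ℝ) (l : ℕ) : ℝ :=
  ∑ k ∈ Finset.range (l + 1),
    (Nat.factorial l : ℝ) / ((Nat.factorial (l - k) : ℝ) * lam ^ k)

/-- The recursion `D lam (l + 1) = 1 + (l + 1) / lam * D lam l`. -/
theorem D_succ {lam : ℝ} (hlam : 0 < lam) (l : ℕ) :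
    D lam (l + 1) = 1 + (l + 1) / lam * D lam l := by
  unfold D
  rw [Finset.sum_range_succ', add_comm, Finset.mul_sum]
  have h1 : ((l + 1).factorial : ℝ) ≠ 0 := by positivity
  congr 1
  · simp [h1]
  · refine Finset.sum_congr rfl fun k _ => ?_
    have h2 : ((l - k).factorial : ℝ) ≠ 0 := by positivity
    rw [Nat.add_sub_add_right, Nat.factorial_succ]
    push_cast
    field_simp
    ring

theorem D_pos {lam : ℝ} (hlam : 0 < lam) (l : ℕ) : 0 < D lam l :=
  Finset.sum_pos (fun k _ => by positivity) ⟨0, by simp⟩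

/-- The expected number of idle servers among the first `l`, in equilibrium. -/
noncomputable def idle (lam : ℝ) (l : ℕ) : ℝ := l - lam + lam / D lam l

theorem idle_zero (lam : ℝ) : idle lam 0 = 0 := by
  simp [idle, D]

theorem one_div_D {lam : ℝ} (hlam : 0 < lam) (l : ℕ) :
    1 / D lam l = 1 - l / lam + idle lam l / lam := by
  have := (D_pos hlam l).ne'
  unfold idle
  field_simp
  ring

theorem idle_succ {lam : ℝ} (hlam : 0 < lam) (l : ℕ) :
    idle lam (l + 1) = (1 + idle lam l) * (l + 1) / (lam + (1 + idle lam l)) := by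
  have h := D_pos hlam l
  have h3 : lam + (l + 1) * D lam l ≠ 0 := by positivity
  have h4 : lam + (1 + (l - lam + lam / D lam l)) ≠ 0 := by
    have : lam + (1 + (l - lam + lam / D lam l)) = l + 1 + lam / D lam l := by ring
    rw [this]; positivity
  have h5 : 1 + ((l : ℝ) + 1) / lam * D lam l ≠ 0 := by positivity
  unfold idle
  rw [D_succ hlam, eq_div_iff h4]
  push_cast
  field_simp
  ring

theorem idle_nonneg {lam : ℝ} (hlam : 0 < lam) (l : ℕ) : 0 ≤ idle lam l := by
  induction l with
  | zero => simp [idle_zero]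
  | succ l ih => rw [idle_succ hlam]; positivity

theorem idle_le {lam : ℝ} (hlam : 0 < lam) (l : ℕ) (hl : (l : ℝ) < lam) :
    idle lam l ≤ lam / (lam - l) := by
  induction l with
  | zero => rw [idle_zero]; simp [hlam.ne']
  | succ l ih =>
    push_cast at hl ⊢
    have ih := ih (by linarith)
    have h0 := idle_nonneg hlam l
    obtain ⟨m, hm⟩ : ∃ m : ℝ, m = lam - (l + 1) := ⟨_, rfl⟩
    have hm0 : 0 < m := by linarith
    rw [show lam - l = m + 1 by linarith, le_div_iff₀ (by linarith)] at ih
    rw [idle_succ hlam, ← hm, show (l : ℝ) + 1 = lam - m by linarith,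
      div_le_div_iff₀ (by positivity) hm0]
    generalize idle lam l = y at *
    -- the claim is affine in `y`, of slope `(lam - m) * m - lam`
    nlinarith [mul_nonneg h0 hm0.le, mul_nonneg h0 (mul_nonneg hm0.le hm0.le),
      mul_le_mul_of_nonneg_left ih hlam.le, mul_pos hlam hm0, sq_nonneg (lam - m)]

/-- A lower barrier for `1 + idle lam l`, as a function of `m = lam - l`. -/
noncomputable def barrier (lam m : ℝ) : ℝ := lam / m - 4 * lam ^ 2 / m ^ 3

theorem barrier_pos_iff {lam m : ℝ} (hlam : 0 < lam) (hm : 0 < m) :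
    0 < barrier lam m ↔ 4 * lam < m ^ 2 := by
  have e : barrier lam m = lam / m ^ 3 * (m ^ 2 - 4 * lam) := by
    unfold barrier; field_simp
  rw [e, mul_pos_iff_of_pos_left (by positivity), sub_pos]

theorem barrier_step {lam m : ℝ} (hlam : 0 < lam) (hm : 1 ≤ m)
    (h : 0 < barrier lam (m + 1)) :
    (barrier lam m - 1) * (lam + barrier lam (m + 1)) ≤
      barrier lam (m + 1) * (lam - m) := by
  have hm0 : 0 < m := by linarith
  have h1 : barrier lam m ≤ lam / m := sub_le_self _ (by positivity)
  have h2 : barrier lam (m + 1) ≤ lam / (m + 1) := sub_le_self _ (by positivity)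
  have h3 : (m + 1) * barrier lam (m + 1) = lam - 4 * lam ^ 2 / (m + 1) ^ 2 := by
    unfold barrier; field_simp
  have h4 : barrier lam m - barrier lam (m + 1) ≤ lam / (m * (m + 1)) := by
    have : 4 * lam ^ 2 / (m + 1) ^ 3 ≤ 4 * lam ^ 2 / m ^ 3 := by gcongr; linarith
    have e : lam / (m * (m + 1)) = lam / m - lam / (m + 1) := by field_simp; ring
    rw [e]; unfold barrier; linarith
  have h5 : barrier lam m * barrier lam (m + 1) ≤ lam / m * (lam / (m + 1)) := by gcongr
  have h6 : lam / m * (lam / (m + 1)) + lam * (lam / (m * (m + 1))) ≤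
      4 * lam ^ 2 / (m + 1) ^ 2 := by
    have e : lam / m * (lam / (m + 1)) + lam * (lam / (m * (m + 1))) =
        2 * lam ^ 2 / (m * (m + 1)) := by field_simp; ring
    rw [e, div_le_div_iff₀ (by positivity) (by positivity)]
    have : 0 ≤ lam ^ 2 * (m + 1) * (m - 1) :=
      mul_nonneg (by positivity) (by linarith)
    nlinarith
  nlinarith [mul_le_mul_of_nonneg_left h4 hlam.le]

theorem barrier_le {lam : ℝ} (hlam : 0 < lam) (l : ℕ) (hl : (l : ℝ) + 1 ≤ lam) :
    barrier lam (lam - l) ≤ 1 + idle lam l := by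
  induction l with
  | zero =>
    rw [idle_zero]
    have : 0 ≤ 4 * lam ^ 2 / lam ^ 3 := by positivity
    simp [barrier, hlam.ne', this]
  | succ l ih =>
    push_cast at hl ⊢
    have ih := ih (by linarith)
    obtain ⟨m, hm⟩ : ∃ m : ℝ, m = lam - (l + 1) := ⟨_, rfl⟩
    have hm1 : 1 ≤ m := by linarith
    have h0 := idle_nonneg hlam l
    have h1 := idle_nonneg hlam (l + 1)
    rw [← hm]
    rw [show lam - l = m + 1 by linarith] at ih
    rcases le_or_gt (barrier lam m) 1 with hb | hb
    · linarith
    have hw : 0 < barrier lam (m + 1) := by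
      have := (barrier_pos_iff hlam (by linarith)).1 (zero_lt_one.trans hb)
      rw [barrier_pos_iff hlam (by linarith)]
      nlinarith
    have key := barrier_step hlam hm1 hw
    rw [← sub_le_iff_le_add', idle_succ hlam, show (l : ℝ) + 1 = lam - m by linarith,
      le_div_iff₀ (by positivity)]
    generalize barrier lam m = v at *
    generalize barrier lam (m + 1) = w at *
    have hc : 0 < lam - m - (v - 1) := by
      have : 0 < (v - 1) * lam := mul_pos (by linarith) hlam
      exact pos_of_mul_pos_right (a := w) (by linarith) hw.le
    nlinarith [mul_le_mul_of_nonneg_right ih hc.le]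

theorem sum_inv_le {lam : ℝ} (N : ℕ) (hN : (N : ℝ) < lam) :
    ∑ l ∈ Finset.range N, (lam - l)⁻¹ ≤ Real.log lam - Real.log (lam - N) := by
  induction N with
  | zero => simp
  | succ N ih =>
    push_cast at hN ⊢
    have ih := ih (by linarith)
    have h1 : 0 < lam - N := by linarith
    have h2 : 0 < lam - (N + 1) := by linarith
    have := Real.one_sub_inv_le_log_of_pos (div_pos h1 h2)
    rw [Real.log_div h1.ne' h2.ne'] at this
    have e : 1 - ((lam - N) / (lam - (N + 1)))⁻¹ = (lam - N)⁻¹ := by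
      field_simp; ring
    rw [Finset.sum_range_succ]
    linarith

theorem le_sum_inv {lam : ℝ} (N : ℕ) (hN : (N : ℝ) < lam) :
    Real.log (lam + 1) - Real.log (lam - N + 1) ≤ ∑ l ∈ Finset.range N, (lam - l)⁻¹ := by
  induction N with
  | zero => simp
  | succ N ih =>
    push_cast at hN ⊢
    have ih := ih (by linarith)
    have h1 : 0 < lam - N := by linarith
    have h2 : 0 < lam - N + 1 := by linarith
    have := Real.log_le_sub_one_of_pos (div_pos h2 h1)
    rw [Real.log_div h2.ne' h1.ne'] at this
    have e : (lam - N + 1) / (lam - N) - 1 = (lam - N)⁻¹ := by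
      field_simp; ring
    rw [Finset.sum_range_succ, show lam - ((N : ℝ) + 1) + 1 = lam - N by ring]
    linarith

theorem sum_inv_cube_le {lam : ℝ} (N : ℕ) (hN : (N : ℝ) < lam) :
    ∑ l ∈ Finset.range N, ((lam - l) ^ 3)⁻¹ ≤ ((lam - N) ^ 2)⁻¹ := by
  induction N with
  | zero => simp; positivity
  | succ N ih =>
    push_cast at hN ⊢
    have ih := ih (by linarith)
    obtain ⟨m, hm⟩ : ∃ m : ℝ, m = lam - (N + 1) := ⟨_, rfl⟩
    have hm0 : 0 < m := by linarith
    rw [Finset.sum_range_succ, ← hm]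
    rw [show lam - N = m + 1 by linarith] at ih ⊢
    have : ((m + 1) ^ 2)⁻¹ + ((m + 1) ^ 3)⁻¹ ≤ (m ^ 2)⁻¹ := by
      have e : ((m + 1) ^ 2)⁻¹ + ((m + 1) ^ 3)⁻¹ = (m + 2) / (m + 1) ^ 3 := by
        field_simp; ring
      rw [e, ← one_div, div_le_div_iff₀ (by positivity) (by positivity)]
      nlinarith
    linarith

theorem sum_one_sub_div {lam : ℝ} (hlam : lam ≠ 0) (N : ℕ) :
    ∑ l ∈ Finset.range N, (1 - (l : ℝ) / lam) = N - N * (N - 1) / (2 * lam) := by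
  induction N with
  | zero => simp
  | succ N ih => rw [Finset.sum_range_succ, ih]; push_cast; field_simp; ring

theorem abs_sum_one_sub_div_sub_le {lam : ℝ} (hlam : 0 < lam) {N : ℕ} (hN : (N : ℝ) ≤ lam)
    (h : (lam - N) ^ 2 ≤ lam) :
    |∑ l ∈ Finset.range N, (1 - (l : ℝ) / lam) - lam / 2| ≤ 1 / 2 := by
  have e : (N : ℝ) - N * (N - 1) / (2 * lam) - lam / 2 =
      1 / 2 - ((lam - N) ^ 2 + (lam - N)) / (2 * lam) := by
    field_simp; ring
  have h1 : ((lam - N) ^ 2 + (lam - N)) / (2 * lam) ≤ 1 := by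
    rw [div_le_one (by positivity)]; linarith [N.cast_nonneg (α := ℝ)]
  have h2 : 0 ≤ ((lam - N) ^ 2 + (lam - N)) / (2 * lam) := by
    have := sub_nonneg.2 hN
    positivity
  rw [sum_one_sub_div hlam.ne', e, abs_le]
  constructor <;> linarith

theorem sum_one_div_D {lam : ℝ} (hlam : 0 < lam) (N : ℕ) :
    ∑ l ∈ Finset.range N, 1 / D lam l =
      ∑ l ∈ Finset.range N, (1 - (l : ℝ) / lam) + (∑ l ∈ Finset.range N, idle lam l) / lam := by
  simp_rw [one_div_D hlam, Finset.sum_add_distrib, Finset.sum_div]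

theorem sum_idle_le {lam : ℝ} (hlam : 0 < lam) (N : ℕ) (hN : (N : ℝ) < lam) :
    (∑ l ∈ Finset.range N, idle lam l) / lam ≤ Real.log lam - Real.log (lam - N) := by
  refine le_trans ?_ (sum_inv_le N hN)
  rw [Finset.sum_div]
  refine Finset.sum_le_sum fun l hl => ?_
  have hl : (l : ℝ) < N := by exact_mod_cast Finset.mem_range.1 hl
  rw [div_le_iff₀ hlam, inv_mul_eq_div]
  exact idle_le hlam l (by linarith)

theorem le_sum_idle {lam : ℝ} (hlam : 0 < lam) (N : ℕ) (hN : (N : ℝ) < lam) :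
    Real.log (lam + 1) - Real.log (lam - N + 1) - 4 * lam / (lam - N) ^ 2 - N / lam ≤
      (∑ l ∈ Finset.range N, idle lam l) / lam := by
  have h : ∑ l ∈ Finset.range N, ((lam - l)⁻¹ - 4 * lam * ((lam - l) ^ 3)⁻¹ - lam⁻¹) ≤
      (∑ l ∈ Finset.range N, idle lam l) / lam := by
    rw [Finset.sum_div]
    refine Finset.sum_le_sum fun l hl => ?_
    have hl : (l : ℝ) + 1 ≤ N := by exact_mod_cast Finset.mem_range.1 hl
    have hb := barrier_le hlam l (by linarith)
    have hm : lam - l ≠ 0 := by linarith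
    have e : (lam - l)⁻¹ - 4 * lam * ((lam - l) ^ 3)⁻¹ - lam⁻¹ =
        (barrier lam (lam - l) - 1) / lam := by
      unfold barrier; field_simp
    rw [e]
    gcongr
    linarith
  refine le_trans ?_ h
  rw [Finset.sum_sub_distrib, Finset.sum_sub_distrib, ← Finset.mul_sum, Finset.sum_const,
    Finset.card_range, nsmul_eq_mul, ← div_eq_mul_inv, div_eq_mul_inv (4 * lam)]
  have := le_sum_inv N hN
  have := mul_le_mul_of_nonneg_left (sum_inv_cube_le N hN) (by positivity : 0 ≤ 4 * lam)
  linarith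

theorem one_div_D_sub {lam : ℝ} (hlam : 0 < lam) (l : ℕ) :
    1 / D lam l - 1 / D lam (l + 1) = 1 / D lam (l + 1) * ((idle lam l + 1) / lam) := by
  have h := D_pos hlam l
  have h' := D_pos hlam (l + 1)
  have e : idle lam l + 1 = lam * (D lam (l + 1) / D lam l - 1) := by
    rw [D_succ hlam]; unfold idle; field_simp; ring
  rw [e]
  field_simp

theorem antitone_one_div_D {lam : ℝ} (hlam : 0 < lam) : Antitone fun l => 1 / D lam l := by
  refine antitone_nat_of_succ_le fun l => ?_
  have h := D_pos hlam (l + 1)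
  have h' := idle_nonneg hlam l
  rw [← sub_nonneg, one_div_D_sub hlam]
  positivity

theorem sum_tail_le {r : ℝ} (hr : 0 < r) {M : ℕ} (hM : r ^ 2 + r ≤ M) (K : ℕ) :
    ∑ i ∈ Finset.range K, 1 / D (r ^ 2) (M + i) ≤ (1 + r) * (1 / D (r ^ 2) M) := by
  have hlam : 0 < r ^ 2 := by positivity
  have key : ∑ i ∈ Finset.range K, 1 / D (r ^ 2) (M + i + 1) ≤
      r * (1 / D (r ^ 2) M - 1 / D (r ^ 2) (M + K)) := by
    induction K with
    | zero => simp
    | succ K ih =>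
      rw [Finset.sum_range_succ]
      have h := one_div_D_sub hlam (M + K)
      have hD := D_pos hlam (M + K)
      have hD' := D_pos hlam (M + K + 1)
      have hi : r ≤ idle (r ^ 2) (M + K) + 1 := by
        have : 0 ≤ r ^ 2 / D (r ^ 2) (M + K) := by positivity
        have : (0 : ℝ) ≤ K := by positivity
        unfold idle
        push_cast
        linarith
      have : 1 / D (r ^ 2) (M + K + 1) ≤
          r * (1 / D (r ^ 2) (M + K) - 1 / D (r ^ 2) (M + K + 1)) := by
        rw [h]
        calc 1 / D (r ^ 2) (M + K + 1) = r * (1 / D (r ^ 2) (M + K + 1) * (r / r ^ 2)) := by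
              field_simp
          _ ≤ _ := by gcongr
      rw [← add_assoc]
      linarith
  have hK := D_pos hlam (M + K)
  have : ∑ i ∈ Finset.range K, 1 / D (r ^ 2) (M + i) ≤
      ∑ i ∈ Finset.range (K + 1), 1 / D (r ^ 2) (M + i) :=
    Finset.sum_le_sum_of_subset_of_nonneg (by simp)
      fun i _ _ => (one_div_pos.2 (D_pos hlam _)).le
  rw [Finset.sum_range_succ'] at this
  have : 0 ≤ r * (1 / D (r ^ 2) (M + K)) := by positivity
  simp only [add_zero, ← add_assoc] at *
  linarith

theorem sum_one_div_D_from_le {r : ℝ} (hr : 2 ≤ r) {N : ℕ} (hN : (N : ℝ) ≤ r ^ 2 - r / 2)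
    (hN' : r ^ 2 - r ≤ N) (K : ℕ) :
    ∑ i ∈ Finset.range K, 1 / D (r ^ 2) (N + i) ≤ 15 := by
  have hlam : 0 < r ^ 2 := by positivity
  have hpos (l : ℕ) : 0 ≤ 1 / D (r ^ 2) l := (one_div_pos.2 (D_pos hlam l)).le
  have hB : 1 / D (r ^ 2) N ≤ 3 / r := by
    have h := idle_le hlam N (by linarith)
    have h2 : r ^ 2 / (r ^ 2 - N) ≤ 2 * r := by
      rw [div_le_iff₀ (by linarith)]; nlinarith
    have e : 1 - N / r ^ 2 + idle (r ^ 2) N / r ^ 2 = (r ^ 2 - N + idle (r ^ 2) N) / r ^ 2 := by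
      field_simp
    rw [one_div_D hlam, e, div_le_div_iff₀ hlam (by linarith)]
    nlinarith
  obtain ⟨W, hW⟩ : ∃ W : ℕ, W = ⌈2 * r⌉₊ := ⟨_, rfl⟩
  have hW1 : 2 * r ≤ W := hW ▸ Nat.le_ceil _
  have hW2 : (W : ℝ) < 2 * r + 1 := hW ▸ Nat.ceil_lt_add_one (by positivity)
  have hanti := antitone_one_div_D hlam
  have h1 : ∑ i ∈ Finset.range W, 1 / D (r ^ 2) (N + i) ≤ W * (3 / r) := by
    refine (Finset.sum_le_card_nsmul _ _ (3 / r) fun i _ =>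
      (hanti (Nat.le_add_right N i)).trans hB).trans ?_
    simp
  have h2 := sum_tail_le (by linarith : 0 < r) (M := N + W) (by push_cast; linarith) K
  have h3 : 1 / D (r ^ 2) (N + W) ≤ 3 / r := (hanti (Nat.le_add_right N W)).trans hB
  calc ∑ i ∈ Finset.range K, 1 / D (r ^ 2) (N + i)
      ≤ ∑ i ∈ Finset.range (W + K), 1 / D (r ^ 2) (N + i) :=
        Finset.sum_le_sum_of_subset_of_nonneg (by simp) fun i _ _ => hpos _
    _ ≤ W * (3 / r) + (1 + r) * (3 / r) := by
        rw [Finset.sum_range_add]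
        simp only [← add_assoc]
        exact add_le_add h1 (h2.trans (by gcongr))
    _ ≤ (2 * r + 1) * (3 / r) + (1 + r) * (3 / r) := by gcongr
    _ ≤ 15 := by
        have : (2 * r + 1) * (3 / r) + (1 + r) * (3 / r) = 9 + 6 / r := by field_simp; ring
        have : 6 / r ≤ 3 := by rw [div_le_iff₀ (by linarith)]; linarith
        linarith

/-- There are constants `C > 0`, `λ₀ > 0` such that for all `λ ≥ λ₀`,
`|Ex[L] − λ/2 − (log λ)/2| ≤ C`, where `Ex[L] = ∑_{l=0}^∞ 1/D_λ(l)`. -/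
theorem first_moment_asymptotics :
    ∃ C > (0 : ℝ), ∃ lam₀ > (0 : ℝ), ∀ lam : ℝ, lam₀ ≤ lam →
      |(∑' l : ℕ, 1 / D lam l) - lam / 2 - Real.log lam / 2| ≤ C := by
  refine ⟨20, by norm_num, 4, by norm_num, fun lam h4 => ?_⟩
  obtain ⟨r, hr, rfl⟩ : ∃ r : ℝ, 2 ≤ r ∧ r ^ 2 = lam :=
    ⟨√lam, Real.le_sqrt_of_sq_le (by linarith), Real.sq_sqrt (by linarith)⟩
  have hr0 : 0 < r := by linarith
  have hlam : 0 < r ^ 2 := by positivity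
  have hpos (l : ℕ) : 0 ≤ 1 / D (r ^ 2) l := (one_div_pos.2 (D_pos hlam l)).le
  obtain ⟨N, hN⟩ : ∃ N : ℕ, N = ⌈r ^ 2 - r⌉₊ := ⟨_, rfl⟩
  have hN1 : r ^ 2 - r ≤ N := hN ▸ Nat.le_ceil _
  have hN2 : (N : ℝ) < r ^ 2 - r + 1 := hN ▸ Nat.ceil_lt_add_one (by nlinarith)
  have hNlt : (N : ℝ) < r ^ 2 := by linarith
  have hmain := abs_le.1 (abs_sum_one_sub_div_sub_le hlam hNlt.le (by nlinarith))
  have hlog : Real.log (r ^ 2) = 2 * Real.log r := by simp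
  have hlog2 : Real.log 2 < 1 := Real.log_two_lt_d9.trans (by norm_num)
  have hup : (∑ l ∈ Finset.range N, idle (r ^ 2) l) / r ^ 2 ≤ Real.log r + 1 := by
    have h := sum_idle_le hlam N hNlt
    have : Real.log (r / 2) ≤ Real.log (r ^ 2 - N) :=
      Real.log_le_log (by positivity) (by linarith)
    rw [Real.log_div hr0.ne' two_ne_zero] at this
    linarith
  have hlow : Real.log r - 18 ≤ (∑ l ∈ Finset.range N, idle (r ^ 2) l) / r ^ 2 := by
    have h := le_sum_idle hlam N hNlt
    have h1 : Real.log (r ^ 2 - N + 1) ≤ Real.log (2 * r) :=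
      Real.log_le_log (by linarith) (by linarith)
    rw [Real.log_mul two_ne_zero hr0.ne'] at h1
    have h2 : Real.log (r ^ 2) ≤ Real.log (r ^ 2 + 1) :=
      Real.log_le_log hlam (by linarith)
    have h3 : 4 * r ^ 2 / (r ^ 2 - N) ^ 2 ≤ 16 := by
      have : 0 < r ^ 2 - N := by linarith
      rw [div_le_iff₀ (by positivity)]
      nlinarith
    have h5 : N / r ^ 2 ≤ 1 := (div_le_one hlam).2 hNlt.le
    linarith
  have hhead := sum_one_div_D hlam N
  have hbound (K : ℕ) : ∑ l ∈ Finset.range K, 1 / D (r ^ 2) l ≤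
      ∑ l ∈ Finset.range N, 1 / D (r ^ 2) l + 15 :=
    calc ∑ l ∈ Finset.range K, 1 / D (r ^ 2) l
        ≤ ∑ l ∈ Finset.range (N + K), 1 / D (r ^ 2) l :=
          Finset.sum_le_sum_of_subset_of_nonneg (by simp) fun i _ _ => hpos _
      _ ≤ _ := by
          rw [Finset.sum_range_add]
          gcongr
          exact sum_one_div_D_from_le hr (by linarith) hN1 K
  have hle := Real.tsum_le_of_sum_range_le hpos hbound
  have hge := (summable_of_sum_range_le hpos hbound).sum_le_tsum (Finset.range N)
    fun l _ => hpos l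
  rw [abs_le]
  constructor <;> linarith
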